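/- There exist ε₀ > 0, δ > 0 and a function m^c : (0,ε₀) → (6−δ, 6+δ) with m^c(ε) → 6 as ε → 0⁺, such that for every ε ∈ (0,ε₀) the polynomial λ ↦ P₇(λ; m^c(ε), ε) has exactly one pair of purely imaginary roots, namely ±i·ω(ε) with ω(ε) > 0, and ω(ε) → √3 as ε → 0⁺. -/

import Mathlib

open Complex Filter Topology

/-- Coefficient a₀ of P₇. -/
noncomputable def a0 (m ε : ℝ) : ℝ := 2 ^ 11 * (ε - 1) ^ 4 * ε ^ 2

/-- Coefficient a₁ of P₇. -/
noncomputable def a1 (m ε : ℝ) : ℝ :=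
  -2 ^ 11 * (ε ^ 2 - ε) ^ 2 *
    ((5 * ε ^ 2 - 2 * ε + 1) * m ^ 2 + 2 * (ε + 1) ^ 2 * m + 4)

/-- Coefficient a₂ of P₇. -/
noncomputable def a2 (m ε : ℝ) : ℝ :=
  (ε ^ 2 - ε) *
    (ε * (59 * ε ^ 3 - 9 * ε ^ 2 + 17 * ε - 3) * m ^ 4 +
     4 * ε * (15 * ε ^ 3 + 15 * ε ^ 2 + 17 * ε + 1) * m ^ 3 +
     4 * (ε + 2) * (ε ^ 3 + 9 * ε ^ 2 + 5 * ε + 1) * m ^ 2 -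
     8 * (2 * ε ^ 3 - 3 * ε ^ 2 - 4 * ε - 3) * m - 8 * (ε - 1) * (ε + 2))

/-- Coefficient a₃ of P₇. -/
noncomputable def a3 (m ε : ℝ) : ℝ :=
  2 ^ 7 *
    (-(ε ^ 2) * (5 * ε - 1) * (9 * ε ^ 3 + ε ^ 2 + 7 * ε - 1) * m ^ 6 -
     2 * ε ^ 2 * (59 * ε ^ 4 - 8 * ε ^ 3 + 74 * ε ^ 2 + 8 * ε - 5) * m ^ 5 -
     4 * ε * (4 * ε ^ 5 + 27 * ε ^ 4 + 24 * ε ^ 3 + 37 * ε ^ 2 + 6 * ε - 2) * m ^ 4 +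
     4 * ε * (4 * ε ^ 5 + 20 * ε ^ 4 - 31 * ε ^ 3 - 23 * ε ^ 2 - 33 * ε - 1) * m ^ 3 +
     4 * (9 * ε ^ 5 + 27 * ε ^ 4 - 15 * ε ^ 3 - 24 * ε ^ 2 - 12 * ε - 1) * m ^ 2 +
     4 * (ε ^ 4 + 17 * ε ^ 3 - 7 * ε ^ 2 - 9 * ε - 2) * m -
     4 * (ε - 1) ^ 2 * (2 * ε + 1))

/-- Coefficient a₄ of P₇. -/
noncomputable def a4 (m ε : ℝ) : ℝ :=
  2 ^ 3 *
    (ε ^ 2 * (9 * ε - 1) ^ 2 * (ε - 1) ^ 2 * m ^ 8 +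
     8 * ε ^ 2 * (ε - 1) * (45 * ε ^ 3 + 5 * ε ^ 2 - 21 * ε + 3) * m ^ 7 +
     8 * ε * (21 * ε ^ 5 - 58 * ε ^ 4 - 84 * ε ^ 3 - 32 * ε ^ 2 + 27 * ε - 2) * m ^ 6 -
     16 * ε * (34 * ε ^ 5 + 42 * ε ^ 4 + 113 * ε ^ 3 + 81 * ε ^ 2 - 7 * ε - 7) * m ^ 5 -
     16 * (7 * ε ^ 6 + 96 * ε ^ 5 + 75 * ε ^ 4 + 176 * ε ^ 3 + 42 * ε ^ 2 - 10 * ε - 2) * m ^ 4 +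
     16 * ε * (6 * ε ^ 4 - 75 * ε ^ 3 - 65 * ε ^ 2 - 117 * ε - 5) * m ^ 3 +
     16 * (29 * ε ^ 4 - 7 * ε ^ 3 - 48 * ε ^ 2 - 31 * ε - 7) * m ^ 2 +
     32 * (ε - 1) * (7 * ε ^ 2 + 14 * ε + 3) * m - 16 * (ε - 1) ^ 2)

/-- Coefficient a₅ of P₇. -/
noncomputable def a5 (m ε : ℝ) : ℝ :=
  2 ^ 5 * m *
    (ε ^ 2 * (ε - 1) ^ 2 * (9 * ε ^ 2 + ε - 2) * m ^ 7 +
     (ε ^ 2 - ε) * (38 * ε ^ 4 + 46 * ε ^ 3 - 39 * ε ^ 2 + 3) * m ^ 6 +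
     (36 * ε ^ 6 + 33 * ε ^ 5 - 123 * ε ^ 4 - 95 * ε ^ 3 + 54 * ε ^ 2 - 1) * m ^ 5 -
     (8 * ε ^ 6 - 8 * ε ^ 5 + 169 * ε ^ 4 + 233 * ε ^ 3 + 25 * ε ^ 2 - 41 * ε - 2) * m ^ 4 -
     (60 * ε ^ 5 + 110 * ε ^ 4 + 320 * ε ^ 3 + 129 * ε ^ 2 - 22 * ε - 21) * m ^ 3 -
     4 * (16 * ε ^ 4 + 37 * ε ^ 3 + 41 * ε ^ 2 + 7 * ε - 5) * m ^ 2 +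
     2 * (4 * ε ^ 3 - 37 * ε ^ 2 - 10 * ε - 5) * m + 4 * (5 * ε ^ 2 - 2 * ε - 3))

/-- Coefficient a₆ of P₇. -/
noncomputable def a6 (m ε : ℝ) : ℝ :=
  2 ^ 3 * m *
    (2 * ε ^ 2 * (ε - 1) ^ 2 * (ε + 1) * (2 * ε - 1) * m ^ 7 +
     (ε ^ 2 - ε) * (16 * ε ^ 4 + 58 * ε ^ 3 - 19 * ε ^ 2 - 10 * ε + 3) * m ^ 6 +
     (16 * ε ^ 6 + 72 * ε ^ 5 - 39 * ε ^ 4 - 171 * ε ^ 3 + 42 * ε ^ 2 + 17 * ε - 1) * m ^ 5 +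
     2 * (20 * ε ^ 5 - 12 * ε ^ 4 - 113 * ε ^ 3 - 69 * ε ^ 2 + 41 * ε + 5) * m ^ 4 -
     (2 * ε + 1) * (18 * ε ^ 3 + 81 * ε ^ 2 + 80 * ε - 51) * m ^ 3 -
     4 * (28 * ε ^ 3 + 31 * ε ^ 2 + 20 * ε - 15) * m ^ 2 -
     4 * (11 * ε - 3) * (ε + 1) * m - 8 * (1 - ε))

/-- Coefficient a₇ of P₇. -/
noncomputable def a7 (m ε : ℝ) : ℝ :=
  2 ^ 4 * (m ^ 2 + m ^ 3) *
    (ε ^ 2 * (ε ^ 2 - 1) * (2 * ε - 1) * m ^ 4 +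
     ε * (2 * ε - 1) * (3 * ε ^ 2 - 3 * ε - 2) * m ^ 3 +
     (2 * ε ^ 4 - 13 * ε ^ 2 + 4 * ε + 1) * m ^ 2 -
     3 * (2 * ε - 1) * (ε + 1) * m + 2 * (1 - 2 * ε))

/-- The seventh-order polynomial P₇(λ;m,ε). -/
noncomputable def P7 (m ε : ℝ) (l : ℂ) : ℂ :=
  (a0 m ε : ℂ) * l ^ 7 + (a1 m ε : ℂ) * l ^ 6 + (a2 m ε : ℂ) * l ^ 5 +
  (a3 m ε : ℂ) * l ^ 4 + (a4 m ε : ℂ) * l ^ 3 + (a5 m ε : ℂ) * l ^ 2 +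
  (a6 m ε : ℂ) * l + (a7 m ε : ℂ)

/-- Real part of `P₇(iυ)` with `s = υ²`. -/
noncomputable def reP (p : ℝ × (ℝ × ℝ)) : ℝ :=
  -a1 p.2.1 p.1 * p.2.2 ^ 3 + a3 p.2.1 p.1 * p.2.2 ^ 2 - a5 p.2.1 p.1 * p.2.2 + a7 p.2.1 p.1

/-- Imaginary part of `P₇(iυ)` divided by `υ`, with `s = υ²`. -/
noncomputable def imP (p : ℝ × (ℝ × ℝ)) : ℝ :=
  -a0 p.2.1 p.1 * p.2.2 ^ 3 + a2 p.2.1 p.1 * p.2.2 ^ 2 - a4 p.2.1 p.1 * p.2.2 + a6 p.2.1 p.1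

/-- The second factor of `a₂`. -/
noncomputable def a2fac (m ε : ℝ) : ℝ :=
    (ε * (59 * ε ^ 3 - 9 * ε ^ 2 + 17 * ε - 3) * m ^ 4 +
     4 * ε * (15 * ε ^ 3 + 15 * ε ^ 2 + 17 * ε + 1) * m ^ 3 +
     4 * (ε + 2) * (ε ^ 3 + 9 * ε ^ 2 + 5 * ε + 1) * m ^ 2 -
     8 * (2 * ε ^ 3 - 3 * ε ^ 2 - 4 * ε - 3) * m - 8 * (ε - 1) * (ε + 2))

lemma P7_imag (m ε υ : ℝ) : P7 m ε (Complex.I * υ) =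
    (reP (ε, (m, υ ^ 2)) : ℂ) + ((υ * imP (ε, (m, υ ^ 2)) : ℝ) : ℂ) * Complex.I := by
  unfold P7 reP imP
  have h2 : Complex.I ^ 2 = -1 := Complex.I_sq
  have h3 : Complex.I ^ 3 = -Complex.I := by rw [pow_succ, h2]; ring
  have h4 : Complex.I ^ 4 = 1 := Complex.I_pow_four
  have h5 : Complex.I ^ 5 = Complex.I := by rw [pow_succ, h4]; ring
  have h6 : Complex.I ^ 6 = -1 := by rw [pow_succ, h5]; rw [← h2]; ring
  have h7 : Complex.I ^ 7 = -Complex.I := by rw [pow_succ, h6]; ring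
  simp only [mul_pow, h2, h3, h4, h5, h6, h7]
  push_cast
  ring

lemma P7_imag_zero (m ε υ : ℝ) : P7 m ε (Complex.I * υ) = 0 ↔
    reP (ε, (m, υ ^ 2)) = 0 ∧ υ * imP (ε, (m, υ ^ 2)) = 0 := by
  rw [P7_imag, Complex.ext_iff]
  simp

/-- The pair of real equations. -/
noncomputable def Fmap (p : ℝ × (ℝ × ℝ)) : ℝ × ℝ := (reP p, imP p)

lemma Fmap_contDiff : ContDiff ℝ 1 Fmap := by
  unfold Fmap reP imP a0 a1 a2 a3 a4 a5 a6 a7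
  fun_prop

lemma Fmap_base : Fmap (0, (6, 3)) = 0 := by
  simp only [Fmap, reP, imP, a0, a1, a2, a3, a4, a5, a6, a7]
  norm_num

lemma Fmap_zero (m s : ℝ) : Fmap (0, (m, s)) =
    (-512 * (m + 1) ^ 2 * s ^ 2
      - 32 * m * (-m ^ 5 + 2 * m ^ 4 + 21 * m ^ 3 + 20 * m ^ 2 - 10 * m - 12) * s
      + 16 * (m ^ 2 + m ^ 3) * (m ^ 2 + 3 * m + 2),
     -8 * (32 * m ^ 4 - 112 * m ^ 2 - 96 * m - 16) * s
      + 8 * m * (-m ^ 5 + 10 * m ^ 4 + 51 * m ^ 3 + 60 * m ^ 2 + 12 * m - 8)) := by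
  simp only [Fmap, reP, imP, a0, a1, a2, a3, a4, a5, a6, a7]
  ext <;> simp only [] <;> ring

lemma deriv_m : HasDerivAt (fun t : ℝ => Fmap (0, (t, 3))) ((1401792, -78400) : ℝ × ℝ) 6 := by
  have hp : ∀ n : ℕ, HasDerivAt (fun t : ℝ => t ^ n) (n * 6 ^ (n - 1)) 6 :=
    fun n => hasDerivAt_pow n 6
  have e : (fun t : ℝ => Fmap (0, (t, 3))) = fun t : ℝ =>
      (96 * t ^ 6 + (-176) * t ^ 5 + (-1952) * t ^ 4 + (-1840) * t ^ 3 + (-3616) * t ^ 2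
        + (-8064) * t ^ 1 + (-4608) * t ^ 0,
       (-8) * t ^ 6 + 80 * t ^ 5 + (-360) * t ^ 4 + 480 * t ^ 3 + 2784 * t ^ 2 + 2240 * t ^ 1
        + 384 * t ^ 0) := by
    funext t
    rw [Fmap_zero]
    ext <;> simp only [] <;> ring
  rw [e]
  apply HasDerivAt.prodMk
  · refine (((((((hp 6).const_mul 96).add ((hp 5).const_mul _)).add ((hp 4).const_mul _)).add
      ((hp 3).const_mul _)).add ((hp 2).const_mul _)).add ((hp 1).const_mul _)).add
      ((hp 0).const_mul _) |>.congr_deriv ?_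
    norm_num
  · refine (((((((hp 6).const_mul _).add ((hp 5).const_mul _)).add ((hp 4).const_mul _)).add
      ((hp 3).const_mul _)).add ((hp 2).const_mul _)).add ((hp 1).const_mul _)).add
      ((hp 0).const_mul _) |>.congr_deriv ?_
    norm_num

lemma deriv_s : HasDerivAt (fun t : ℝ => Fmap (0, (6, t))) ((-150528, -294784) : ℝ × ℝ) 3 := by
  have hp : ∀ n : ℕ, HasDerivAt (fun t : ℝ => t ^ n) (n * 3 ^ (n - 1)) 3 :=
    fun n => hasDerivAt_pow n 3
  have e : (fun t : ℝ => Fmap (0, (6, t))) = fun t : ℝ =>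
      ((-25088) * t ^ 2 + 225792 * t ^ 0, (-294784) * t ^ 1 + 884352 * t ^ 0) := by
    funext t
    rw [Fmap_zero]
    ext <;> simp only [] <;> ring
  rw [e]
  apply HasDerivAt.prodMk
  · refine ((hp 2).const_mul _).add ((hp 0).const_mul _) |>.congr_deriv ?_
    norm_num
  · refine ((hp 1).const_mul _).add ((hp 0).const_mul _) |>.congr_deriv ?_
    norm_num

lemma exists_curve : ∃ ψ : ℝ → ℝ × ℝ, Tendsto ψ (𝓝 0) (𝓝 (6, 3)) ∧
    ∀ᶠ ε in 𝓝 (0 : ℝ), Fmap (ε, ψ ε) = 0 := by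
  have hd : HasStrictFDerivAt Fmap (fderiv ℝ Fmap (0, (6, 3))) (0, (6, 3)) :=
    Fmap_contDiff.contDiffAt.hasStrictFDerivAt one_ne_zero
  have h1 : fderiv ℝ Fmap (0, (6, 3)) (0, (1, 0)) = (1401792, -78400) := by
    have hl : HasDerivAt (fun t : ℝ => ((0, (t, 3)) : ℝ × (ℝ × ℝ))) (0, (1, 0)) 6 :=
      (hasDerivAt_const _ _).prodMk ((hasDerivAt_id _).prodMk (hasDerivAt_const _ _))
    exact (HasFDerivAt.comp_hasDerivAt (l := Fmap) (6 : ℝ) hd.hasFDerivAt hl).unique deriv_m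
  have h2 : fderiv ℝ Fmap (0, (6, 3)) (0, (0, 1)) = (-150528, -294784) := by
    have hl : HasDerivAt (fun t : ℝ => ((0, (6, t)) : ℝ × (ℝ × ℝ))) (0, (0, 1)) 3 :=
      (hasDerivAt_const _ _).prodMk ((hasDerivAt_const _ _).prodMk (hasDerivAt_id _))
    exact (HasFDerivAt.comp_hasDerivAt (l := Fmap) (3 : ℝ) hd.hasFDerivAt hl).unique deriv_s
  set L := fderiv ℝ Fmap (0, (6, 3)) with hL
  have hinj : Function.Injective (L ∘L .inr ℝ ℝ (ℝ × ℝ)) := by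
    rw [injective_iff_map_eq_zero]
    rintro ⟨x, y⟩ h
    have hxy : ((0, (x, y)) : ℝ × (ℝ × ℝ)) = x • (0, (1, 0)) + y • (0, (0, 1)) := by simp
    have h' : L (0, (x, y)) = 0 := h
    rw [hxy, map_add, map_smul, map_smul, h1, h2, Prod.ext_iff] at h'
    simp at h'
    obtain ⟨e1, e2⟩ := h'
    have hx : x = 0 := by linarith
    have hy : y = 0 := by linarith
    simp [hx, hy]
  have hinv : (L ∘L .inr ℝ ℝ (ℝ × ℝ)).IsInvertible := by
    refine ⟨(LinearEquiv.ofInjectiveEndo (L ∘L .inr ℝ ℝ (ℝ × ℝ)).toLinearMap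
      hinj).toContinuousLinearEquiv, ?_⟩
    ext <;> rfl
  refine ⟨hd.implicitFunctionOfProdDomain hinv, hd.tendsto_implicitFunctionOfProdDomain hinv, ?_⟩
  have := hd.eventually_apply_implicitFunctionOfProdDomain hinv
  rw [Fmap_base] at this
  exact this

lemma imP_unique {m ε s t : ℝ} (h0 : 0 ≤ a0 m ε) (h2 : a2 m ε ≤ 0) (h4 : 0 < a4 m ε)
    (hs : 0 < s) (ht : 0 < t) (es : imP (ε, (m, s)) = 0) (et : imP (ε, (m, t)) = 0) : s = t := by
  simp only [imP] at es et
  have key : (s - t) * (a0 m ε * (s ^ 2 + s * t + t ^ 2) + (-a2 m ε) * (s + t) + a4 m ε) = 0 := by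
    linear_combination et - es
  have pos : 0 < a0 m ε * (s ^ 2 + s * t + t ^ 2) + (-a2 m ε) * (s + t) + a4 m ε := by
    have := mul_nonneg h0 (by positivity : 0 ≤ s ^ 2 + s * t + t ^ 2)
    have := mul_nonneg (neg_nonneg.2 h2) (by positivity : 0 ≤ s + t)
    linarith
  rcases mul_eq_zero.1 key with h | h
  · linarith
  · exact absurd h pos.ne'

/-- there exist ε₀ > 0, δ > 0 and a function
m^c : (0,ε₀) → (6−δ,6+δ) with m^c(ε) → 6 as ε → 0⁺, such that for every
ε ∈ (0,ε₀) the polynomial P₇(·;m^c(ε),ε) has exactly one pair of purely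
imaginary roots ±i·ω(ε) with ω(ε) > 0, and ω(ε) → √3 as ε → 0⁺. -/
theorem critical_curve_and_imaginary_pair :
    ∃ ε₀ > (0:ℝ), ∃ δ > (0:ℝ), ∃ mc ω : ℝ → ℝ,
      (∀ ε ∈ Set.Ioo (0:ℝ) ε₀, mc ε ∈ Set.Ioo (6 - δ) (6 + δ)) ∧
      Tendsto mc (𝓝[>] (0:ℝ)) (𝓝 6) ∧
      (∀ ε ∈ Set.Ioo (0:ℝ) ε₀,
        0 < ω ε ∧
        (∀ υ : ℝ, P7 (mc ε) ε (Complex.I * υ) = 0 ↔ (υ = ω ε ∨ υ = -ω ε))) ∧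
      Tendsto ω (𝓝[>] (0:ℝ)) (𝓝 (Real.sqrt 3)) := by
  obtain ⟨ψ, hψ, hF⟩ := exists_curve
  have hm : Tendsto (fun ε => (ψ ε).1) (𝓝 0) (𝓝 6) := (continuous_fst.tendsto _).comp hψ
  have hs : Tendsto (fun ε => (ψ ε).2) (𝓝 0) (𝓝 3) := (continuous_snd.tendsto _).comp hψ
  have hpair : Tendsto (fun ε => ((ψ ε).1, ε)) (𝓝 0) (𝓝 ((6 : ℝ), (0 : ℝ))) :=
    hm.prodMk_nhds tendsto_id
  have c4 : Continuous (fun p : ℝ × ℝ => a4 p.1 p.2) := by unfold a4; fun_prop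
  have c7 : Continuous (fun p : ℝ × ℝ => a7 p.1 p.2) := by unfold a7; fun_prop
  have c2 : Continuous (fun p : ℝ × ℝ => a2fac p.1 p.2) := by unfold a2fac; fun_prop
  have e4 : ∀ᶠ ε in 𝓝 (0 : ℝ), 0 < a4 (ψ ε).1 ε :=
    ((c4.tendsto _).comp hpair).eventually_const_lt (by simp only [a4]; norm_num)
  have e7 : ∀ᶠ ε in 𝓝 (0 : ℝ), 0 < a7 (ψ ε).1 ε :=
    ((c7.tendsto _).comp hpair).eventually_const_lt (by simp only [a7]; norm_num)
  have e2 : ∀ᶠ ε in 𝓝 (0 : ℝ), 0 < a2fac (ψ ε).1 ε :=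
    ((c2.tendsto _).comp hpair).eventually_const_lt (by simp only [a2fac]; norm_num)
  have es : ∀ᶠ ε in 𝓝 (0 : ℝ), 0 < (ψ ε).2 := hs.eventually_const_lt (by norm_num)
  have em : ∀ᶠ ε in 𝓝 (0 : ℝ), (ψ ε).1 ∈ Set.Ioo (6 - 1 : ℝ) (6 + 1) :=
    hm.eventually (Ioo_mem_nhds (by norm_num) (by norm_num))
  have e1 : ∀ᶠ ε in 𝓝 (0 : ℝ), ε < 1 := eventually_lt_nhds one_pos
  obtain ⟨ε₀, hε₀, H⟩ := Metric.eventually_nhds_iff.1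
    (hF.and (e4.and (e7.and (e2.and (es.and (em.and e1))))))
  have H' : ∀ ε ∈ Set.Ioo (0:ℝ) ε₀, _ := fun ε hε => @H ε (by
    rw [Real.dist_eq, sub_zero, abs_of_pos hε.1]; exact hε.2)
  refine ⟨ε₀, hε₀, 1, one_pos, fun ε => (ψ ε).1, fun ε => Real.sqrt (ψ ε).2,
    fun ε hε => (H' ε hε).2.2.2.2.2.1, hm.mono_left nhdsWithin_le_nhds, ?_,
    ((Real.continuous_sqrt.tendsto _).comp hs).mono_left nhdsWithin_le_nhds⟩
  intro ε hε
  obtain ⟨f, p4, p7, p2, ps, -, p1⟩ := H' ε hε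
  have fr : reP (ε, ((ψ ε).1, (ψ ε).2)) = 0 := congrArg Prod.fst f
  have fi : imP (ε, ((ψ ε).1, (ψ ε).2)) = 0 := congrArg Prod.snd f
  refine ⟨Real.sqrt_pos.2 ps, fun υ => ?_⟩
  rw [P7_imag_zero, ← sq_eq_sq_iff_eq_or_eq_neg, Real.sq_sqrt ps.le]
  constructor
  · rintro ⟨hr, hi⟩
    have hυ : υ ≠ 0 := by
      rintro rfl
      simp [reP] at hr
      exact p7.ne' hr
    have hi' := (mul_eq_zero.1 hi).resolve_left hυ
    refine imP_unique (m := (ψ ε).1) (ε := ε) ?_ ?_ p4 (by positivity) ps hi' fi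
    · unfold a0; positivity
    · have e : a2 (ψ ε).1 ε = (ε ^ 2 - ε) * a2fac (ψ ε).1 ε := rfl
      rw [e]
      have : ε ^ 2 - ε ≤ 0 := by nlinarith [hε.1]
      exact mul_nonpos_of_nonpos_of_nonneg this p2.le
  · intro h
    rw [h]
    exact ⟨fr, by rw [fi, mul_zero]⟩
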